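/- arXiv:1310.4123 — 5 statements merged into one kernel-verified Lean document; each statement's English description precedes it below -/
import Mathlib

section
/- Downwards Induction Theorem (abstract diagram form of the paper's Theorem 'Downwards Induction'). Fix n ∈ ℤ. Assume that the comparison maps φ : K_n → K̄_n and φ : K_{n−1} → K̄_{n−1} are isomorphisms, and that for both ε = 1 and ε = −1 the comparison maps φ : KQ_n^ε → KQ̄_n^ε and the induced maps on co-Witt groups W'_{n−1}^ε → W̄'_{n−1}^ε are isomorphisms. Then for both ε = 1 and ε = −1 the comparison maps V_{n−1}^ε → V̄_{n−1}^ε, U_{n−1}^ε → Ū_{n−1}^ε, U_n^ε → Ū_n^ε, V_{n−2}^ε → V̄_{n−2}^ε, KQ_{n−1}^ε → KQ̄_{n−1}^ε, and the induced maps W'_{n−2}^ε → W̄'_{n−2}^ε are all isomorphisms. -/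
/-- The map induced by a commuting square on the kernels of the horizontal maps
(used for the co-Witt groups `W' = ker F`). -/
def coWittMap {G G' C C' : Type} [AddCommGroup G] [AddCommGroup G']
    [AddCommGroup C] [AddCommGroup C']
    (F : G →+ C) (F' : G' →+ C') (φG : G →+ G') (φC : C →+ C')
    (hcomm : ∀ x : G, φC (F x) = F' (φG x)) : F.ker →+ F'.ker :=
  (φG.domRestrict F.ker).codRestrict F'.ker (fun x => by
    have hx : F (x : G) = 0 := AddMonoidHom.mem_ker.mp x.2
    have : F' (φG (x : G)) = 0 := by rw [← hcomm, hx, map_zero]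
    simpa [AddMonoidHom.mem_ker] using this)

section CoWittComparison

variable {Q K V N Q' K' V' N' C C' : Type} [AddCommGroup Q] [AddCommGroup K] [AddCommGroup V]
  [AddCommGroup N] [AddCommGroup Q'] [AddCommGroup K'] [AddCommGroup V'] [AddCommGroup N']
  [AddCommGroup C'] [AddCommGroup C]

/-- If the comparison map on co-Witt groups and the comparison map on the targets are injective,
then so is the comparison map on the sources. -/
lemma injective_of_coWittMap_injective {F : N →+ C} {F' : N' →+ C'} {φN : N →+ N'} {φC : C →+ C'}
    (hF : ∀ x, φC (F x) = F' (φN x)) (hC : Function.Injective φC)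
    (hW : Function.Injective (coWittMap F F' φN φC hF)) : Function.Injective φN := by
  rw [injective_iff_map_eq_zero]
  intro x hx
  have hFx : F x = 0 := hC (by rw [hF, hx, map_zero, map_zero])
  have h : (⟨x, hFx⟩ : F.ker) = 0 := hW (Subtype.ext (hx.trans (by simp)))
  exact congrArg Subtype.val h

variable {φQ : Q →+ Q'} {φK : K →+ K'} {φV : V →+ V'} {φN : N →+ N'} {φC : C →+ C'}
  {f' : Q' →+ K'} {d' : K' →+ V'} {a' : V' →+ N'} {F' : N' →+ C'}
  {f : Q →+ K} {d : K →+ V} {a : V →+ N} {F : N →+ C}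

/-- The comparison map on `V` is bijective if those on the two preceding groups of the exact
sequence and on the co-Witt group that follows it are. -/
lemma bijective_of_coWittMap_bijective
    (hfd : Function.Exact f d) (hda : Function.Exact d a) (haF : Function.Exact a F)
    (hfd' : Function.Exact f' d') (hda' : Function.Exact d' a')
    (haF' : Function.Exact a' F')
    (hf : ∀ x, φK (f x) = f' (φQ x)) (hd : ∀ x, φV (d x) = d' (φK x))
    (ha : ∀ x, φN (a x) = a' (φV x)) (hF : ∀ x, φC (F x) = F' (φN x))
    (hQ : Function.Surjective φQ) (hK : Function.Bijective φK)
    (hW : Function.Bijective (coWittMap F F' φN φC hF)) : Function.Bijective φV := by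
  constructor
  · rw [injective_iff_map_eq_zero]
    intro x hx
    have hax : (⟨a x, haF.apply_apply_eq_zero x⟩ : F.ker) = 0 :=
      hW.1 (Subtype.ext ((ha x).trans (by simp [hx])))
    obtain ⟨y, rfl⟩ := (hda x).1 (congrArg Subtype.val hax)
    obtain ⟨q', hq'⟩ := (hfd' (φK y)).1 (by rw [← hd, hx])
    obtain ⟨q, rfl⟩ := hQ q'
    exact (hfd y).2 ⟨q, hK.1 ((hf q).trans hq')⟩
  · intro x'
    obtain ⟨⟨z, hz⟩, hz'⟩ := hW.2 ⟨a' x', haF'.apply_apply_eq_zero x'⟩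
    replace hz' : φN z = a' x' := congrArg Subtype.val hz'
    obtain ⟨x, rfl⟩ := (haF z).1 hz
    obtain ⟨y', hy'⟩ := (hda' (x' - φV x)).1 (by rw [map_sub, ← hz', ha, sub_self])
    obtain ⟨y, rfl⟩ := hK.2 y'
    exact ⟨x + d y, by rw [map_add, hd, hy', add_sub_cancel]⟩

/-- The comparison map on the co-Witt group is bijective if those on the two preceding groups of
the exact sequence are. -/
lemma coWittMap_bijective
    (hda : Function.Exact d a) (haF : Function.Exact a F)
    (hda' : Function.Exact d' a') (haF' : Function.Exact a' F')
    (hd : ∀ x, φV (d x) = d' (φK x)) (ha : ∀ x, φN (a x) = a' (φV x))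
    (hF : ∀ x, φC (F x) = F' (φN x))
    (hK : Function.Surjective φK) (hV : Function.Bijective φV) :
    Function.Bijective (coWittMap F F' φN φC hF) := by
  constructor
  · rw [injective_iff_map_eq_zero]
    rintro ⟨z, hz⟩ hz'
    replace hz' : φN z = 0 := congrArg Subtype.val hz'
    obtain ⟨x, rfl⟩ := (haF z).1 hz
    obtain ⟨y', hy'⟩ := (hda' (φV x)).1 (by rw [← ha, hz'])
    obtain ⟨y, rfl⟩ := hK y'
    exact Subtype.ext ((hda x).2 ⟨y, hV.1 ((hd y).trans hy')⟩)
  · rintro ⟨z', hz'⟩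
    obtain ⟨x', rfl⟩ := (haF' z').1 hz'
    obtain ⟨x, rfl⟩ := hV.2 x'
    exact ⟨⟨a x, haF.apply_apply_eq_zero x⟩, Subtype.ext (ha x)⟩

end CoWittComparison

/-- **Downwards Induction Theorem** (abstract diagram form).  Here `ε` ranges over
`Bool`, `!ε` playing the role of `-ε`; `K`, `KQ`, `V`, `U` (resp. their primed
versions) are the two systems, `F`/`H` the forgetful/hyperbolic maps, `a, d`
(resp. `b, e`) the remaining maps of the exact sequence of the fibration of the
forgetful (resp. hyperbolic) map, `φK, φKQ, φV, φU` the comparison maps, and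
`ψ, ψ'` the isomorphisms of the Fundamental Theorem of Hermitian K-theory. -/
theorem downwards_induction
    (K : ℤ → Type) (KQ V U : Bool → ℤ → Type)
    (K' : ℤ → Type) (KQ' V' U' : Bool → ℤ → Type)
    [∀ n, AddCommGroup (K n)] [∀ ε n, AddCommGroup (KQ ε n)]
    [∀ ε n, AddCommGroup (V ε n)] [∀ ε n, AddCommGroup (U ε n)]
    [∀ n, AddCommGroup (K' n)] [∀ ε n, AddCommGroup (KQ' ε n)]
    [∀ ε n, AddCommGroup (V' ε n)] [∀ ε n, AddCommGroup (U' ε n)]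
    (F : ∀ ε n, KQ ε n →+ K n) (H : ∀ ε n, K n →+ KQ ε n)
    (a : ∀ ε n, V ε n →+ KQ ε n) (d : ∀ ε n, K n →+ V ε (n - 1))
    (b : ∀ ε n, U ε n →+ K n) (e : ∀ ε n, KQ ε n →+ U ε (n - 1))
    (F' : ∀ ε n, KQ' ε n →+ K' n) (H' : ∀ ε n, K' n →+ KQ' ε n)
    (a' : ∀ ε n, V' ε n →+ KQ' ε n) (d' : ∀ ε n, K' n →+ V' ε (n - 1))
    (b' : ∀ ε n, U' ε n →+ K' n) (e' : ∀ ε n, KQ' ε n →+ U' ε (n - 1))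
    -- exactness of the two long sequences of the first system
    (exVKQ : ∀ ε n, Function.Exact ⇑(a ε n) ⇑(F ε n))
    (exVK : ∀ ε n, Function.Exact ⇑(F ε n) ⇑(d ε n))
    (exVV : ∀ ε n, Function.Exact ⇑(d ε n) ⇑(a ε (n - 1)))
    (exUK : ∀ ε n, Function.Exact ⇑(b ε n) ⇑(H ε n))
    (exUKQ : ∀ ε n, Function.Exact ⇑(H ε n) ⇑(e ε n))
    (exUU : ∀ ε n, Function.Exact ⇑(e ε n) ⇑(b ε (n - 1)))
    -- exactness of the two long sequences of the second system
    (exVKQ' : ∀ ε n, Function.Exact ⇑(a' ε n) ⇑(F' ε n))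
    (exVK' : ∀ ε n, Function.Exact ⇑(F' ε n) ⇑(d' ε n))
    (exVV' : ∀ ε n, Function.Exact ⇑(d' ε n) ⇑(a' ε (n - 1)))
    (exUK' : ∀ ε n, Function.Exact ⇑(b' ε n) ⇑(H' ε n))
    (exUKQ' : ∀ ε n, Function.Exact ⇑(H' ε n) ⇑(e' ε n))
    (exUU' : ∀ ε n, Function.Exact ⇑(e' ε n) ⇑(b' ε (n - 1)))
    -- comparison maps, commuting with all structure maps
    (φK : ∀ n, K n →+ K' n) (φKQ : ∀ ε n, KQ ε n →+ KQ' ε n)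
    (φV : ∀ ε n, V ε n →+ V' ε n) (φU : ∀ ε n, U ε n →+ U' ε n)
    (hφF : ∀ ε n x, φK n (F ε n x) = F' ε n (φKQ ε n x))
    (hφH : ∀ ε n x, φKQ ε n (H ε n x) = H' ε n (φK n x))
    (hφa : ∀ ε n x, φKQ ε n (a ε n x) = a' ε n (φV ε n x))
    (hφd : ∀ ε n x, φV ε (n - 1) (d ε n x) = d' ε n (φK n x))
    (hφb : ∀ ε n x, φK n (b ε n x) = b' ε n (φU ε n x))
    (hφe : ∀ ε n x, φU ε (n - 1) (e ε n x) = e' ε n (φKQ ε n x))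
    -- the Fundamental Theorem of Hermitian K-theory in both systems
    (ψ : ∀ ε n, V ε n ≃+ U (!ε) (n + 1))
    (ψ' : ∀ ε n, V' ε n ≃+ U' (!ε) (n + 1))
    (hψ : ∀ ε n x, φU (!ε) (n + 1) (ψ ε n x) = ψ' ε n (φV ε n x))
    -- hypotheses of the theorem, for a fixed `n`
    (n : ℤ)
    (hK : Function.Bijective (φK n))
    (hK1 : Function.Bijective (φK (n - 1)))
    (hKQ : ∀ ε, Function.Bijective (φKQ ε n))
    (hW1 : ∀ ε, Function.Bijective
      (coWittMap (F ε (n - 1)) (F' ε (n - 1)) (φKQ ε (n - 1)) (φK (n - 1))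
        (hφF ε (n - 1)))) :
    ∀ ε,
      Function.Bijective (φV ε (n - 1)) ∧
      Function.Bijective (φU ε (n - 1)) ∧
      Function.Bijective (φU ε n) ∧
      Function.Bijective (φV ε (n - 2)) ∧
      Function.Bijective (φKQ ε (n - 1)) ∧
      Function.Bijective
        (coWittMap (F ε (n - 2)) (F' ε (n - 2)) (φKQ ε (n - 2)) (φK (n - 2))
          (hφF ε (n - 2))) := by
  have hV1 (ε) : Function.Bijective (φV ε (n - 1)) :=
    bijective_of_coWittMap_bijective (exVK ε n) (exVV ε n) (exVKQ ε (n - 1)) (exVK' ε n)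
      (exVV' ε n) (exVKQ' ε (n - 1)) (hφF ε n) (hφd ε n) (hφa ε (n - 1)) (hφF ε (n - 1))
      (hKQ ε).2 hK (hW1 ε)
  have hVU (ε m) : Function.Bijective (φU (!ε) (m + 1)) ↔ Function.Bijective (φV ε m) := by
    have h : φU (!ε) (m + 1) ∘ ψ ε m = ψ' ε m ∘ φV ε m := funext (hψ ε m)
    rw [← Function.Bijective.of_comp_iff _ (ψ ε m).bijective, h,
      Function.Bijective.of_comp_iff' (ψ' ε m).bijective]
  have hU (ε) : Function.Bijective (φU ε n) := by
    rw [← sub_add_cancel n 1, ← Bool.not_not ε]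
    exact (hVU (!ε) (n - 1)).2 (hV1 _)
  have hU1 (ε) : Function.Bijective (φU ε (n - 1)) :=
    AddMonoidHom.bijective_of_surjective_of_bijective_of_bijective_of_injective
      (H ε n) (e ε n) (b ε (n - 1)) (H ε (n - 1))
      (H' ε n) (e' ε n) (b' ε (n - 1)) (H' ε (n - 1))
      (φK n) (φKQ ε n) (φU ε (n - 1)) (φK (n - 1)) (φKQ ε (n - 1))
      (AddMonoidHom.ext fun x => (hφH ε n x).symm) (AddMonoidHom.ext fun x => (hφe ε n x).symm)
      (AddMonoidHom.ext fun x => (hφb ε (n - 1) x).symm)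
      (AddMonoidHom.ext fun x => (hφH ε (n - 1) x).symm)
      (exUKQ ε n) (exUU ε n) (exUK ε (n - 1)) (exUKQ' ε n) (exUU' ε n) (exUK' ε (n - 1))
      hK.2 (hKQ ε) hK1
      (injective_of_coWittMap_injective (hφF ε (n - 1)) hK1.1 (hW1 ε).1)
  have hV2 (ε) : Function.Bijective (φV ε (n - 1 - 1)) :=
    (hVU ε (n - 1 - 1)).1 (by rw [sub_add_cancel]; exact hU1 _)
  have hKQ1 (ε) : Function.Bijective (φKQ ε (n - 1)) :=
    AddMonoidHom.bijective_of_surjective_of_bijective_of_bijective_of_injective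
      (d ε n) (a ε (n - 1)) (F ε (n - 1)) (d ε (n - 1))
      (d' ε n) (a' ε (n - 1)) (F' ε (n - 1)) (d' ε (n - 1))
      (φK n) (φV ε (n - 1)) (φKQ ε (n - 1)) (φK (n - 1)) (φV ε (n - 1 - 1))
      (AddMonoidHom.ext fun x => (hφd ε n x).symm)
      (AddMonoidHom.ext fun x => (hφa ε (n - 1) x).symm)
      (AddMonoidHom.ext fun x => (hφF ε (n - 1) x).symm)
      (AddMonoidHom.ext fun x => (hφd ε (n - 1) x).symm)
      (exVV ε n) (exVKQ ε (n - 1)) (exVK ε (n - 1))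
      (exVV' ε n) (exVKQ' ε (n - 1)) (exVK' ε (n - 1))
      hK.2 (hV1 ε) hK1 (hV2 ε).1
  have hn : n - 2 = n - 1 - 1 := by ring
  rw [hn]
  exact fun ε => ⟨hV1 ε, hU1 ε, hU ε, hV2 ε, hKQ1 ε,
    coWittMap_bijective (exVV ε (n - 1)) (exVKQ ε (n - 1 - 1)) (exVV' ε (n - 1))
      (exVKQ' ε (n - 1 - 1)) (hφd ε (n - 1)) (hφa ε (n - 1 - 1)) (hφF ε (n - 1 - 1)) hK1.2
      (hV2 ε)⟩
end

section
/- Characterization of bounded left approximate identities (the paper's Proposition on bounded approximate identities). For every Banach algebra A over 𝕜 the following are equivalent: (a) for every unital Banach algebra B over 𝕜 containing A as a closed right ideal there exists a continuous linear map λ : A* → B* such that i* ∘ λ = id_{A*} and λ(φ·b) = λ(φ)·b for all φ ∈ A* and b ∈ B (a bounded B-linear splitting of the dual extension); (b) there exists a unital Banach algebra B₀ over 𝕜 containing A as a closed right ideal together with a continuous linear map s : B₀** → A** satisfying s ∘ i** = id_{A**} and s(Θ·b) = s(Θ)·b for all Θ ∈ B₀** and b ∈ B₀ (a bounded B₀-linear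 splitting of the bidual extension); (c) A possesses a bounded left approximate identity. -/
open NormedSpace

/-- `A` possesses a left approximate identity bounded by `M`: a net `(e_i)` over
a nonempty directed index set with `‖e i‖ ≤ M` and `‖e i * a - a‖ → 0` for
every `a`. -/
def HasBoundedLeftApproxId (A : Type) [NonUnitalNormedRing A] (M : ℝ) : Prop :=
  ∃ (I : Type) (pre : Preorder I),
    Nonempty I ∧ IsDirected I (fun s t => pre.le s t) ∧
    ∃ e : I → A, (∀ i : I, ‖e i‖ ≤ M) ∧
      ∀ a : A, Filter.Tendsto (fun i => ‖e i * a - a‖) (@Filter.atTop I pre) (nhds 0)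

/-- A witness for condition (b): a unital Banach algebra `B₀` containing `A` as
a closed right ideal (via the isometric multiplicative embedding `j`, with
right-ideal structure `m`, `j (m a b) = j a * b`), together with a bounded
`B₀`-linear splitting `s : B₀** → A**` of the bidual extension, i.e.
`s ∘ i** = id` and `s(Θ·b) = s(Θ)·b`.  The module actions are characterized
pointwise: `i** θ` is the functional `ψ ↦ θ(ψ ∘ j)`; for `ψ ∈ B₀*`,
`ψ·b = (y ↦ ψ (y * b))`; for `Θ ∈ B₀**`, `(Θ·b)(ψ) = Θ(ψ·b)`; for `φ ∈ A*`,
`(φ·b)(a) = φ (m a b)`; for `θ ∈ A**`, `(θ·b)(φ) = θ(φ·b)`. -/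
structure BidualSplittingWitness (𝕜 : Type) [RCLike 𝕜] (A : Type)
    [NonUnitalNormedRing A] [NormedSpace 𝕜 A]
    [IsScalarTower 𝕜 A A] [SMulCommClass 𝕜 A A] : Type 1 where
  B₀ : Type
  [normedRingB₀ : NormedRing B₀]
  [normedAlgebraB₀ : NormedAlgebra 𝕜 B₀]
  [completeSpaceB₀ : CompleteSpace B₀]
  j : A →L[𝕜] B₀
  m : A → B₀ → A
  j_mul : ∀ x y : A, j (x * y) = j x * j y
  j_isometry : ∀ x : A, ‖j x‖ = ‖x‖
  j_ideal : ∀ (x : A) (b : B₀), j (m x b) = j x * b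
  s : StrongDual 𝕜 (StrongDual 𝕜 B₀) →L[𝕜] StrongDual 𝕜 (StrongDual 𝕜 A)
  s_split : ∀ (θ : StrongDual 𝕜 (StrongDual 𝕜 A)) (Θ : StrongDual 𝕜 (StrongDual 𝕜 B₀)),
    (∀ ψ : StrongDual 𝕜 B₀, Θ ψ = θ (ψ.comp j)) → s Θ = θ
  s_linear : ∀ (Θ Θb : StrongDual 𝕜 (StrongDual 𝕜 B₀)) (b : B₀),
    (∀ (ψ ψb : StrongDual 𝕜 B₀), (∀ y : B₀, ψb y = ψ (y * b)) → Θb ψ = Θ ψb) →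
    ∀ (φ φb : StrongDual 𝕜 A), (∀ x : A, φb x = φ (m x b)) → s Θb φ = s Θ φb

/-- **Helly's lemma.** If `E` in the bidual of `X` is mapped to `y : Y` by the second adjoint
of `T : X →L[𝕜] Y`, then `y` is a limit of images of vectors of norm at most `‖E‖`. -/
theorem mem_closure_image_closedBall_of_bidual {𝕜 X Y : Type*} [RCLike 𝕜]
    [NormedAddCommGroup X] [NormedSpace 𝕜 X] [NormedAddCommGroup Y] [NormedSpace 𝕜 Y]
    (T : X →L[𝕜] Y) (y : Y) (E : StrongDual 𝕜 (StrongDual 𝕜 X))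
    (hE : ∀ φ : StrongDual 𝕜 Y, E (φ.comp T) = φ y) :
    y ∈ closure (T '' Metric.closedBall 0 ‖E‖) := by
  let _ : NormedSpace ℝ X := NormedSpace.restrictScalars ℝ 𝕜 X
  let _ : NormedSpace ℝ Y := NormedSpace.restrictScalars ℝ 𝕜 Y
  have : IsScalarTower ℝ 𝕜 X := IsScalarTower.of_algebraMap_smul fun _ _ => rfl
  have : IsScalarTower ℝ 𝕜 Y := IsScalarTower.of_algebraMap_smul fun _ _ => rfl
  by_contra hy
  have hconv : Convex ℝ (closure (T '' Metric.closedBall 0 ‖E‖)) :=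
    ((convex_closedBall (0 : X) ‖E‖).linear_image (T.restrictScalars ℝ).toLinearMap).closure
  obtain ⟨f, u, hu, hf⟩ :=
    RCLike.geometric_hahn_banach_closed_point (𝕜 := 𝕜) hconv isClosed_closure hy
  have hu0 : 0 < u := by
    simpa using hu 0 (subset_closure
      ⟨0, Metric.mem_closedBall_self (norm_nonneg E), map_zero T⟩)
  set ψ : StrongDual 𝕜 X := f.comp T
  have hbound : ‖E‖ * ‖ψ‖ ≤ u := by
    rcases (norm_nonneg E).eq_or_lt with h0 | h0
    · rw [← h0]; simpa using hu0.le
    · rw [← le_div_iff₀' h0]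
      refine ContinuousLinearMap.opNorm_bound_of_ball_bound h0 u ψ fun z hz => ?_
      obtain ⟨c, hc, hcz⟩ := RCLike.exists_norm_eq_mul_self (ψ z)
      have hcmem : c • z ∈ Metric.closedBall (0 : X) ‖E‖ := by
        simpa [norm_smul, hc] using hz
      have hlt := hu _ (subset_closure ⟨c • z, hcmem, rfl⟩)
      rw [map_smul, map_smul, smul_eq_mul] at hlt
      change RCLike.re (c * ψ z) < u at hlt
      rw [← hcz, RCLike.ofReal_re] at hlt
      exact hlt.le
  have h1 : RCLike.re (f y) ≤ ‖E‖ * ‖ψ‖ := by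
    rw [← hE f]
    exact (RCLike.re_le_norm _).trans (E.le_opNorm _)
  linarith

/-- A weak* cluster point in the bidual of a bounded net, presented as an ultrafilter limit. -/
theorem exists_bidual_tendsto {𝕜 X ι : Type*} [RCLike 𝕜] [NormedAddCommGroup X]
    [NormedSpace 𝕜 X] (U : Ultrafilter ι) (e : ι → X) (M : ℝ) (he : ∀ i, ‖e i‖ ≤ M) :
    ∃ E : StrongDual 𝕜 (StrongDual 𝕜 X), ∀ φ : StrongDual 𝕜 X,
      Filter.Tendsto (fun i => φ (e i)) U (nhds (E φ)) := by
  let g : ι → WeakDual 𝕜 (StrongDual 𝕜 X) := fun i =>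
    StrongDual.toWeakDual (inclusionInDoubleDual 𝕜 X (e i))
  obtain ⟨E, -, hE⟩ := (WeakDual.isCompact_closedBall (𝕜 := 𝕜) (E := StrongDual 𝕜 X) 0 M)
    |>.ultrafilter_le_nhds (U.map g) (by
      refine Filter.le_principal_iff.mpr (Filter.mem_map.mpr (Filter.univ_mem' fun i => ?_))
      simpa [g] using (double_dual_bound 𝕜 X (e i)).trans (he i))
  exact ⟨WeakDual.toStrongDual E, fun φ =>
    ((WeakDual.eval_continuous φ).tendsto E).comp (f := g) (x := U) hE⟩

/-- A functional `E` in the bidual of `A` with `E (φ · a) = φ a`, i.e. a weak* left identity,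
yields a left approximate identity bounded by `‖E‖`. -/
theorem hasBoundedLeftApproxId_of_bidual {𝕜 A : Type} [RCLike 𝕜] [NonUnitalNormedRing A]
    [NormedSpace 𝕜 A] [IsScalarTower 𝕜 A A] [SMulCommClass 𝕜 A A]
    (E : StrongDual 𝕜 (StrongDual 𝕜 A))
    (hE : ∀ (φ : StrongDual 𝕜 A) (a : A),
      E (φ.comp ((ContinuousLinearMap.mul 𝕜 A).flip a)) = φ a) :
    HasBoundedLeftApproxId A ‖E‖ := by
  classical
  have key : ∀ p : Finset A × ℕ, ∃ e : A, ‖e‖ ≤ ‖E‖ ∧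
      ∀ a ∈ p.1, ‖e * a - a‖ < 1 / ((p.2 : ℝ) + 1) := by
    rintro ⟨F, n⟩
    let T : A →L[𝕜] (F → A) :=
      ContinuousLinearMap.pi fun a => (ContinuousLinearMap.mul 𝕜 A).flip a
    have hmem := mem_closure_image_closedBall_of_bidual T (fun a : F => (a : A)) E fun φ => by
      have hφ : ∀ v : F → A,
          φ v = ∑ a, φ.comp (ContinuousLinearMap.single 𝕜 (fun _ : F => A) a) (v a) := by
        intro v
        conv_lhs => rw [← Finset.univ_sum_single v, map_sum]
        rfl
      have hcomp : φ.comp T = ∑ a : F,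
          (φ.comp (ContinuousLinearMap.single 𝕜 (fun _ : F => A) a)).comp
            ((ContinuousLinearMap.mul 𝕜 A).flip a) := by
        ext x
        rw [ContinuousLinearMap.comp_apply, hφ]
        simp [T]
      rw [hcomp, map_sum, hφ]
      exact Finset.sum_congr rfl fun a _ => hE _ _
    obtain ⟨_, ⟨e, he, rfl⟩, hdist⟩ :=
      Metric.mem_closure_iff.mp hmem (1 / ((n : ℝ) + 1)) Nat.one_div_pos_of_nat
    refine ⟨e, by simpa using he, fun a ha => ?_⟩
    have := (dist_le_pi_dist (fun a : F => (a : A)) (T e) ⟨a, ha⟩).trans_lt hdist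
    rwa [dist_comm, dist_eq_norm] at this
  choose e he hlt using key
  refine ⟨Finset A × ℕ, inferInstance, inferInstance, inferInstance, e, he, fun a => ?_⟩
  have hlim : Filter.Tendsto (fun p : Finset A × ℕ => 1 / ((p.2 : ℝ) + 1)) Filter.atTop
      (nhds 0) := by
    rw [← Filter.prod_atTop_atTop_eq]
    exact tendsto_one_div_add_atTop_nhds_zero_nat.comp Filter.tendsto_snd
  refine squeeze_zero' (Filter.Eventually.of_forall fun _ => norm_nonneg _) ?_ hlim
  filter_upwards [Filter.eventually_ge_atTop (({a}, 0) : Finset A × ℕ)] with p hp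
  exact (hlt p a (hp.1 (Finset.mem_singleton_self a))).le

section RightIdeal

variable {𝕜 A B : Type} [RCLike 𝕜] [NonUnitalNormedRing A] [NormedSpace 𝕜 A]
  [NormedRing B] [NormedAlgebra 𝕜 B]

/-- The action `b ↦ (a ↦ a * b)` of `B` on a right ideal `A`, as a bounded bilinear map. -/
theorem exists_rightAction (j : A →L[𝕜] B) (m : A → B → A) (hiso : ∀ x : A, ‖j x‖ = ‖x‖)
    (hm : ∀ (x : A) (b : B), j (m x b) = j x * b) :
    ∃ R : B →L[𝕜] A →L[𝕜] A, ∀ b x, R b x = m x b := by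
  have hinj : Function.Injective j :=
    (AddMonoidHomClass.isometry_of_norm j hiso).injective
  refine ⟨LinearMap.mkContinuous₂ (LinearMap.mk₂ 𝕜 (fun b x => m x b) ?_ ?_ ?_ ?_) 1 ?_,
    fun b x => rfl⟩
  · intro b c x; apply hinj; simp [hm, mul_add]
  · intro c b x; apply hinj; simp [hm]
  · intro b x y; apply hinj; simp [hm, add_mul]
  · intro c b x; apply hinj; simp [hm]
  · intro b x
    rw [LinearMap.mk₂_apply, ← hiso, hm, one_mul, ← hiso x, mul_comm]
    exact norm_mul_le _ _

/-- A bounded left approximate identity yields a `B`-linear splitting of the dual extension,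
`lam φ b = lim φ (e i * b)` along an ultrafilter. -/
theorem HasBoundedLeftApproxId.exists_dual_splitting {M : ℝ} (h : HasBoundedLeftApproxId A M)
    (j : A →L[𝕜] B) (m : A → B → A) (hmul : ∀ x y : A, j (x * y) = j x * j y)
    (hiso : ∀ x : A, ‖j x‖ = ‖x‖) (hm : ∀ (x : A) (b : B), j (m x b) = j x * b) :
    ∃ lam : StrongDual 𝕜 A →L[𝕜] StrongDual 𝕜 B,
      (∀ (φ : StrongDual 𝕜 A) (x : A), lam φ (j x) = φ x) ∧
      (∀ (φ φb : StrongDual 𝕜 A) (b : B),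
        (∀ x : A, φb x = φ (m x b)) → ∀ y : B, lam φb y = lam φ (y * b)) := by
  obtain ⟨I, pre, hne, hdir, e, he, hlim⟩ := h
  have hinj : Function.Injective j :=
    (AddMonoidHomClass.isometry_of_norm j hiso).injective
  obtain ⟨R, hR⟩ := exists_rightAction j m hiso hm
  have : (Filter.atTop : Filter I).NeBot := Filter.atTop_neBot
  let U : Ultrafilter I := Ultrafilter.of Filter.atTop
  obtain ⟨E, hE⟩ := exists_bidual_tendsto (𝕜 := 𝕜) U e M he
  refine ⟨(ContinuousLinearMap.compL 𝕜 B (StrongDual 𝕜 A) 𝕜 E).comp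
    (((ContinuousLinearMap.compL 𝕜 B (A →L[𝕜] A) (StrongDual 𝕜 A)).flip R).comp
      (ContinuousLinearMap.compL 𝕜 A A 𝕜)), fun φ x => ?_, fun φ φb b hb y => ?_⟩
  · change E (φ.comp (R (j x))) = φ x
    refine tendsto_nhds_unique (hE _) ?_
    have hx : Filter.Tendsto (fun i => e i * x) U (nhds x) :=
      (tendsto_iff_norm_sub_tendsto_zero.mpr (hlim x)).mono_left (Ultrafilter.of_le Filter.atTop)
    refine ((φ.continuous.tendsto x).comp hx).congr fun i => congrArg φ (hinj ?_)
    change j (e i * x) = j (R (j x) (e i))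
    rw [hR, hm, hmul]
  · change E (φb.comp (R y)) = E (φ.comp (R (y * b)))
    congr 1
    ext x
    simp only [ContinuousLinearMap.comp_apply, hR, hb]
    exact congrArg φ (hinj (by simp only [hm, mul_assoc]))

end RightIdeal

/-- Condition (b) implies condition (c): evaluate the splitting at the unit of `B₀`. -/
theorem BidualSplittingWitness.exists_hasBoundedLeftApproxId {𝕜 : Type} [RCLike 𝕜] {A : Type}
    [NonUnitalNormedRing A] [NormedSpace 𝕜 A] [IsScalarTower 𝕜 A A] [SMulCommClass 𝕜 A A]
    (w : BidualSplittingWitness 𝕜 A) : ∃ M : ℝ, HasBoundedLeftApproxId A M := by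
  obtain ⟨B₀, j, m, hmul, hiso, hm, s, hsplit, hlin⟩ := w
  have hinj : Function.Injective j :=
    (AddMonoidHomClass.isometry_of_norm j hiso).injective
  refine ⟨_, hasBoundedLeftApproxId_of_bidual (s (inclusionInDoubleDual 𝕜 B₀ 1))
    fun φ a => ?_⟩
  rw [← hlin _ (inclusionInDoubleDual 𝕜 B₀ (j a)) (j a) (fun ψ ψb h => ?_) φ _ fun x => ?_]
  · rw [hsplit (inclusionInDoubleDual 𝕜 A a) _ fun ψ => rfl]
    rfl
  · simp [h]
  · exact congrArg φ (hinj (by simp [hm, hmul]))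

/-- A dual splitting for the `ℓ¹`-unitization yields a bidual splitting, by taking adjoints. -/
theorem nonempty_bidualSplittingWitness (𝕜 : Type) [RCLike 𝕜] (A : Type)
    [NonUnitalNormedRing A] [NormedSpace 𝕜 A]
    [IsScalarTower 𝕜 A A] [SMulCommClass 𝕜 A A] [CompleteSpace A]
    (h : ∀ (B : Type) [NormedRing B] [NormedAlgebra 𝕜 B] [CompleteSpace B]
      (j : A →L[𝕜] B) (m : A → B → A),
      (∀ x y : A, j (x * y) = j x * j y) → (∀ x : A, ‖j x‖ = ‖x‖) →
      (∀ (x : A) (b : B), j (m x b) = j x * b) →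
      ∃ lam : StrongDual 𝕜 A →L[𝕜] StrongDual 𝕜 B,
        (∀ (φ : StrongDual 𝕜 A) (x : A), lam φ (j x) = φ x) ∧
        (∀ (φ φb : StrongDual 𝕜 A) (b : B),
          (∀ x : A, φb x = φ (m x b)) → ∀ y : B, lam φb y = lam φ (y * b))) :
    Nonempty (BidualSplittingWitness 𝕜 A) := by
  let j : A →L[𝕜] WithLp 1 (Unitization 𝕜 A) :=
    LinearMap.mkContinuous
      ((WithLp.linearEquiv 1 𝕜 (Unitization 𝕜 A)).symm.toLinearMap ∘ₗ
        (Unitization.inrHom 𝕜 𝕜 A : A →ₗ[𝕜] Unitization 𝕜 A)) 1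
      fun x => by simpa using (WithLp.unitization_norm_inr (𝕜 := 𝕜) x).le
  let m : A → WithLp 1 (Unitization 𝕜 A) → A := fun x b =>
    (WithLp.ofLp b).fst • x + x * (WithLp.ofLp b).snd
  have hj : ∀ x, j x = WithLp.toLp 1 (x : Unitization 𝕜 A) := fun x => rfl
  have hmul : ∀ x y : A, j (x * y) = j x * j y := fun x y => by
    apply WithLp.ofLp_injective
    simp [hj]
  have hiso : ∀ x : A, ‖j x‖ = ‖x‖ := WithLp.unitization_norm_inr
  have hm : ∀ (x : A) b, j (m x b) = j x * b := fun x b => by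
    apply WithLp.ofLp_injective
    ext <;> simp [hj, m]
  obtain ⟨lam, hlam, hlin⟩ := h _ j m hmul hiso hm
  let s : StrongDual 𝕜 (StrongDual 𝕜 (WithLp 1 (Unitization 𝕜 A))) →L[𝕜]
      StrongDual 𝕜 (StrongDual 𝕜 A) := ContinuousLinearMap.precomp 𝕜 lam
  refine ⟨{
    B₀ := WithLp 1 (Unitization 𝕜 A)
    j := j
    m := m
    j_mul := hmul
    j_isometry := hiso
    j_ideal := hm
    s := s
    s_split := fun θ Θ hΘ => ?_
    s_linear := fun Θ Θb b hΘ φ φb hφ => hΘ (lam φ) (lam φb) (hlin φ φb b hφ) }⟩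
  ext φ
  refine (hΘ (lam φ)).trans (congrArg θ ?_)
  ext x
  exact hlam φ x

/-- **Characterization of bounded left approximate identities.**  For a Banach
algebra `A` the following are equivalent: (a) for every unital Banach algebra
`B` containing `A` as a closed right ideal (via an isometric multiplicative
embedding `j` with right-ideal structure `m`), the dual extension admits a
bounded `B`-linear splitting `λ : A* → B*` with `i* ∘ λ = id` and
`λ(φ·b) = λ(φ)·b`; (b) there is a unital Banach algebra `B₀` containing `A`
as a closed right ideal such that the bidual extension admits a bounded
`B₀`-linear splitting; (c) `A` possesses a bounded left approximate
identity. -/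
theorem blai_characterization
    (𝕜 : Type) [RCLike 𝕜] (A : Type)
    [NonUnitalNormedRing A] [NormedSpace 𝕜 A]
    [IsScalarTower 𝕜 A A] [SMulCommClass 𝕜 A A] [CompleteSpace A] :
    List.TFAE
      [ -- (a)
        (∀ (B : Type) [NormedRing B] [NormedAlgebra 𝕜 B] [CompleteSpace B],
          ∀ (j : A →L[𝕜] B) (m : A → B → A),
          (∀ x y : A, j (x * y) = j x * j y) →
          (∀ x : A, ‖j x‖ = ‖x‖) →
          (∀ (x : A) (b : B), j (m x b) = j x * b) →
          ∃ lam : StrongDual 𝕜 A →L[𝕜] StrongDual 𝕜 B,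
            (∀ (φ : StrongDual 𝕜 A) (x : A), lam φ (j x) = φ x) ∧
            (∀ (φ φb : StrongDual 𝕜 A) (b : B),
              (∀ x : A, φb x = φ (m x b)) →
              ∀ y : B, lam φb y = lam φ (y * b))),
        -- (b)
        Nonempty (BidualSplittingWitness 𝕜 A),
        -- (c)
        (∃ M : ℝ, HasBoundedLeftApproxId A M) ] := by
  tfae_have 1 → 2 := nonempty_bidualSplittingWitness 𝕜 A
  tfae_have 2 → 3 := fun ⟨w⟩ => w.exists_hasBoundedLeftApproxId
  tfae_have 3 → 1 := fun ⟨_, h⟩ _ _ _ _ j m hmul hiso hm =>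
    h.exists_dual_splitting j m hmul hiso hm
  tfae_finish
end

section
/- Quantitative splitting from a bounded left approximate identity. Let B be a unital Banach algebra over 𝕜 and A a closed right ideal of B possessing a bounded left approximate identity with bound M. Then there exists a continuous linear map λ : A* → B* with ‖λ‖ ≤ M such that λ(φ)(a) = φ(a) for all φ ∈ A* and a ∈ A (i.e., i* ∘ λ = id_{A*}), and λ(φ·b) = λ(φ)·b for all φ ∈ A* and b ∈ B. -/
open NormedSpace

/-- A bounded family of scalars converges along every ultrafilter. -/
lemma exists_tendsto_ultrafilter_of_norm_le {I E : Type*} [NormedAddCommGroup E] [ProperSpace E]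
    (U : Ultrafilter I) (f : I → E) (C : ℝ) (hf : ∀ i, ‖f i‖ ≤ C) :
    ∃ L, Filter.Tendsto f U (nhds L) := by
  obtain ⟨L, -, hL⟩ := (isCompact_closedBall (0 : E) C).ultrafilter_le_nhds (U.map f)
    (Filter.le_principal_iff.2 (Filter.mem_map.2 (Filter.Eventually.of_forall fun i =>
      mem_closedBall_zero_iff.2 (hf i))))
  exact ⟨L, hL⟩

/-- **Quantitative splitting from a bounded left approximate identity.**  The
Banach algebra `A` is realized as a closed right ideal of the unital Banach
algebra `B` by an isometric multiplicative continuous linear embedding `j`;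
`m a b` is the element of `A` carried by `j` to `j a * b` (the right-ideal
property).  If `A` has a left approximate identity bounded by `M`, then there
is a continuous linear map `λ : A* → B*` of norm at most `M` with
`i* ∘ λ = id` (`λ φ (j a) = φ a`) which is `B`-linear: `λ(φ·b) = λ(φ)·b`,
i.e. if `φb = φ·b` (that is, `φb a = φ (m a b)` for all `a`) then
`λ φb y = λ φ (y * b)` for all `y ∈ B`. -/
theorem quantitative_dual_splitting
    (𝕜 : Type) [RCLike 𝕜]
    (A : Type) [NonUnitalNormedRing A] [NormedSpace 𝕜 A]
    [IsScalarTower 𝕜 A A] [SMulCommClass 𝕜 A A] [CompleteSpace A]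
    (B : Type) [NormedRing B] [NormedAlgebra 𝕜 B] [CompleteSpace B]
    (j : A →L[𝕜] B) (m : A → B → A)
    (hjmul : ∀ x y : A, j (x * y) = j x * j y)
    (hjiso : ∀ x : A, ‖j x‖ = ‖x‖)
    (hjideal : ∀ (x : A) (b : B), j (m x b) = j x * b)
    (M : ℝ) (hM : HasBoundedLeftApproxId A M) :
    ∃ lam : StrongDual 𝕜 A →L[𝕜] StrongDual 𝕜 B,
      ‖lam‖ ≤ M ∧
      (∀ (φ : StrongDual 𝕜 A) (x : A), lam φ (j x) = φ x) ∧
      (∀ (φ φb : StrongDual 𝕜 A) (b : B),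
        (∀ x : A, φb x = φ (m x b)) →
        ∀ y : B, lam φb y = lam φ (y * b)) := by
  obtain ⟨I, pre, hne, hdir, e, he, hea⟩ := hM
  have hM0 : 0 ≤ M := (norm_nonneg _).trans (he hne.some)
  have hjinj : Function.Injective j :=
    (AddMonoidHomClass.isometry_of_norm j hjiso).injective
  have hmadd (a : A) (y z : B) : m a (y + z) = m a y + m a z :=
    hjinj (by simp [hjideal, mul_add])
  have hmsmul (c : 𝕜) (a : A) (y : B) : m a (c • y) = c • m a y :=
    hjinj (by simp [hjideal])
  have hmmul (a : A) (y b : B) : m (m a y) b = m a (y * b) :=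
    hjinj (by simp [hjideal, mul_assoc])
  have hmj (a x : A) : m a (j x) = a * x := hjinj (by simp [hjideal, hjmul])
  have hmnorm (a : A) (y : B) : ‖m a y‖ ≤ ‖a‖ * ‖y‖ := by
    rw [← hjiso, hjideal, ← hjiso a]
    exact norm_mul_le _ _
  have : (@Filter.atTop I pre).NeBot := Filter.atTop_neBot
  let U : Ultrafilter I := Ultrafilter.of (@Filter.atTop I pre)
  have hbound (φ : StrongDual 𝕜 A) (y : B) (i : I) :
      ‖φ (m (e i) y)‖ ≤ M * ‖φ‖ * ‖y‖ :=
    calc ‖φ (m (e i) y)‖ ≤ ‖φ‖ * ‖m (e i) y‖ := φ.le_opNorm _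
      _ ≤ ‖φ‖ * (M * ‖y‖) := by
        gcongr
        exact (hmnorm _ _).trans (by gcongr; exact he i)
      _ = M * ‖φ‖ * ‖y‖ := by ring
  choose L hL using fun (φ : StrongDual 𝕜 A) (y : B) =>
    exists_tendsto_ultrafilter_of_norm_le U (fun i => φ (m (e i) y)) _ (hbound φ y)
  let l : StrongDual 𝕜 A →ₗ[𝕜] B →ₗ[𝕜] 𝕜 := LinearMap.mk₂ 𝕜 L
    (fun φ ψ y => tendsto_nhds_unique (hL (φ + ψ) y) ((hL φ y).add (hL ψ y)))
    (fun c φ y => tendsto_nhds_unique (hL (c • φ) y) ((hL φ y).const_smul c))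
    (fun φ y z => tendsto_nhds_unique (hL φ (y + z))
      (by simpa only [hmadd, map_add] using (hL φ y).add (hL φ z)))
    (fun c φ y => tendsto_nhds_unique (hL φ (c • y))
      (by simpa only [hmsmul, map_smul] using (hL φ y).const_smul c))
  have hl (φ : StrongDual 𝕜 A) (y : B) : ‖l φ y‖ ≤ M * ‖φ‖ * ‖y‖ :=
    le_of_tendsto (hL φ y).norm (Filter.Eventually.of_forall (hbound φ y))
  refine ⟨l.mkContinuous₂ M hl, l.mkContinuous₂_norm_le hM0 hl, fun φ x => ?_,
    fun φ φb b hφb y => ?_⟩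
  · refine tendsto_nhds_unique (hL φ (j x)) ?_
    simp only [hmj]
    exact (φ.continuous.tendsto x).comp
      ((tendsto_iff_norm_sub_tendsto_zero.2 (hea x)).mono_left (Ultrafilter.of_le _))
  · refine tendsto_nhds_unique (hL φb y) ?_
    simp only [hφb, hmmul]
    exact hL φ (y * b)
end

section
/- Purity criterion for extensions of Banach spaces (the paper's Lemma in the Appendix on bounded approximate identities and ⊗̂_π, in dualized form). Let 0 → F →(i) E →(p) D → 0 be a short exact sequence of Banach spaces over 𝕜. The following are equivalent: (a) for every Banach space C over 𝕜 the sequence 0 → L(C, D*) → L(C, E*) → L(C, F*) → 0, whose maps are T ↦ p* ∘ T and T ↦ i* ∘ T, is exact; (b) the sequence in (a) is exact for C = F*; (c) the dual extension 0 → D* →(p*) E* →(i*) F* → 0 is split, i.e., there exists a continuous linear map λ : F* → E* with i* ∘ λ = id_{F*}. -/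
open NormedSpace

/-- The adjoint (dual map) of a continuous linear map, as a continuous linear
map between the dual spaces: `u* ψ = ψ ∘ u`. -/
noncomputable def dualCLM (𝕜 : Type) [RCLike 𝕜] {X Y : Type}
    [NormedAddCommGroup X] [NormedSpace 𝕜 X]
    [NormedAddCommGroup Y] [NormedSpace 𝕜 Y] (u : X →L[𝕜] Y) :
    StrongDual 𝕜 Y →L[𝕜] StrongDual 𝕜 X :=
  (ContinuousLinearMap.compL 𝕜 X Y 𝕜).flip u

theorem dualCLM_injective (𝕜 : Type) [RCLike 𝕜] {E D : Type}
    [NormedAddCommGroup E] [NormedSpace 𝕜 E] [NormedAddCommGroup D] [NormedSpace 𝕜 D]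
    {p : E →L[𝕜] D} (hp : Function.Surjective p) :
    Function.Injective (dualCLM 𝕜 p) := by
  intro g h hgh
  ext d
  obtain ⟨x, rfl⟩ := hp d
  exact DFunLike.congr_fun hgh x

/-- The dual of a strict short exact sequence is exact in the middle. -/
theorem range_dualCLM_eq_ker (𝕜 : Type) [RCLike 𝕜] {F E D : Type}
    [NormedAddCommGroup F] [NormedSpace 𝕜 F]
    [NormedAddCommGroup E] [NormedSpace 𝕜 E] [CompleteSpace E]
    [NormedAddCommGroup D] [NormedSpace 𝕜 D] [CompleteSpace D]
    {i : F →L[𝕜] E} {p : E →L[𝕜] D}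
    (hip : ∀ x : E, p x = 0 ↔ x ∈ Set.range i) (hp : Function.Surjective p) :
    Set.range (dualCLM 𝕜 p) = (dualCLM 𝕜 i) ⁻¹' {0} := by
  ext f
  constructor
  · rintro ⟨g, rfl⟩
    ext y
    change g (p (i y)) = 0
    rw [(hip (i y)).2 ⟨y, rfl⟩, map_zero]
  · intro hf
    obtain ⟨q, hq⟩ := (p : E →ₗ[𝕜] D).exists_rightInverse_of_surjective
      (LinearMap.range_eq_top.2 hp)
    have hpq (d : D) : p (q d) = d := LinearMap.congr_fun hq d
    have hfq (x : E) : f (q (p x)) = f x := by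
      obtain ⟨y, hy⟩ := (hip (q (p x) - x)).1 (by rw [map_sub, hpq, sub_self])
      have hfy : f (i y) = 0 := DFunLike.congr_fun (Set.mem_singleton_iff.1 hf) y
      rwa [hy, map_sub, sub_eq_zero] at hfy
    have hcont : Continuous ((f : E →ₗ[𝕜] 𝕜) ∘ₗ q) := by
      rw [(p.isQuotientMap hp).continuous_iff]
      exact f.continuous.congr fun x => (hfq x).symm
    exact ⟨⟨(f : E →ₗ[𝕜] 𝕜) ∘ₗ q, hcont⟩, ContinuousLinearMap.ext hfq⟩

/-- The functor `L(C, -)` is left exact on the dual of a short exact sequence. -/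
theorem dualCLM_comp_eq_zero_iff (𝕜 : Type) [RCLike 𝕜] {F E D : Type}
    [NormedAddCommGroup F] [NormedSpace 𝕜 F]
    [NormedAddCommGroup E] [NormedSpace 𝕜 E] [CompleteSpace E]
    [NormedAddCommGroup D] [NormedSpace 𝕜 D] [CompleteSpace D]
    {i : F →L[𝕜] E} {p : E →L[𝕜] D}
    (hip : ∀ x : E, p x = 0 ↔ x ∈ Set.range i) (hp : Function.Surjective p)
    {C : Type} [NormedAddCommGroup C] [NormedSpace 𝕜 C] (T : C →L[𝕜] StrongDual 𝕜 E) :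
    (dualCLM 𝕜 i).comp T = 0 ↔
      ∃ S : C →L[𝕜] StrongDual 𝕜 D, (dualCLM 𝕜 p).comp S = T := by
  have hrange := range_dualCLM_eq_ker 𝕜 hip hp
  constructor
  · intro hT
    have hclosed : IsClosed (Set.range (dualCLM 𝕜 p)) := by
      rw [hrange]
      exact isClosed_singleton.preimage (dualCLM 𝕜 i).continuous
    have hmem (c : C) : T c ∈ (dualCLM 𝕜 p).range := by
      change T c ∈ Set.range (dualCLM 𝕜 p)
      rw [hrange]
      exact DFunLike.congr_fun hT c
    let e := (dualCLM 𝕜 p).equivRange (dualCLM_injective 𝕜 hp) hclosed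
    refine ⟨(e.symm : _ →L[𝕜] StrongDual 𝕜 D).comp (T.codRestrict _ hmem), ?_⟩
    ext1 c
    exact congrArg Subtype.val (e.apply_symm_apply ⟨T c, hmem c⟩)
  · rintro ⟨S, rfl⟩
    ext1 c
    have h : dualCLM 𝕜 p (S c) ∈ (dualCLM 𝕜 i) ⁻¹' {0} := hrange ▸ Set.mem_range_self (S c)
    exact h

/-- **Purity criterion for extensions of Banach spaces** (dualized form).
For a short exact sequence `0 → F →(i) E →(p) D → 0` of Banach spaces the
following are equivalent: (a) the induced sequence
`0 → L(C, D*) → L(C, E*) → L(C, F*) → 0` is exact for every Banach space `C`;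
(b) it is exact for `C = F*`; (c) the dual extension is split. -/
theorem purity_criterion
    (𝕜 : Type) [RCLike 𝕜]
    (F E D : Type)
    [NormedAddCommGroup F] [NormedSpace 𝕜 F] [CompleteSpace F]
    [NormedAddCommGroup E] [NormedSpace 𝕜 E] [CompleteSpace E]
    [NormedAddCommGroup D] [NormedSpace 𝕜 D] [CompleteSpace D]
    (i : F →L[𝕜] E) (p : E →L[𝕜] D)
    (hi : Function.Injective i)
    (hip : ∀ x : E, p x = 0 ↔ x ∈ Set.range i)
    (hp : Function.Surjective p) :
    List.TFAE
      [ -- (a)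
        (∀ (C : Type) [NormedAddCommGroup C] [NormedSpace 𝕜 C] [CompleteSpace C],
          Function.Injective
            (fun T : C →L[𝕜] StrongDual 𝕜 D => (dualCLM (X := E) (Y := D) 𝕜 p).comp T) ∧
          (∀ T : C →L[𝕜] StrongDual 𝕜 E,
            (dualCLM (X := F) (Y := E) 𝕜 i).comp T = 0 ↔
              ∃ S : C →L[𝕜] StrongDual 𝕜 D, (dualCLM (X := E) (Y := D) 𝕜 p).comp S = T) ∧
          Function.Surjective
            (fun T : C →L[𝕜] StrongDual 𝕜 E => (dualCLM (X := F) (Y := E) 𝕜 i).comp T)),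
        -- (b)
        (Function.Injective
          (fun T : StrongDual 𝕜 F →L[𝕜] StrongDual 𝕜 D =>
            (dualCLM (X := E) (Y := D) 𝕜 p).comp T) ∧
        (∀ T : StrongDual 𝕜 F →L[𝕜] StrongDual 𝕜 E,
          (dualCLM (X := F) (Y := E) 𝕜 i).comp T = 0 ↔
            ∃ S : StrongDual 𝕜 F →L[𝕜] StrongDual 𝕜 D,
              (dualCLM (X := E) (Y := D) 𝕜 p).comp S = T) ∧
        Function.Surjective
          (fun T : StrongDual 𝕜 F →L[𝕜] StrongDual 𝕜 E =>
            (dualCLM (X := F) (Y := E) 𝕜 i).comp T)),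
        -- (c)
        (∃ lam : StrongDual 𝕜 F →L[𝕜] StrongDual 𝕜 E,
          ∀ φ : StrongDual 𝕜 F, dualCLM (X := F) (Y := E) 𝕜 i (lam φ) = φ) ] := by
  tfae_have 1 → 2 := fun h => h (StrongDual 𝕜 F)
  tfae_have 2 → 3 := by
    rintro ⟨-, -, h⟩
    obtain ⟨lam, hlam⟩ := h (ContinuousLinearMap.id 𝕜 (StrongDual 𝕜 F))
    exact ⟨lam, fun φ => DFunLike.congr_fun hlam φ⟩
  tfae_have 3 → 1 := by
    rintro ⟨lam, hlam⟩ C _ _ _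
    refine ⟨fun S T h => ?_, dualCLM_comp_eq_zero_iff 𝕜 hip hp, fun T => ⟨lam.comp T, ?_⟩⟩
    · ext1 c
      exact dualCLM_injective 𝕜 hp (DFunLike.congr_fun h c)
    · ext1 c
      exact hlam (T c)
  tfae_finish
end

section
/- Exactness of a short sequence of Banach spaces is equivalent to exactness of its dual sequence. Let i : F → E and p : E → D be continuous linear maps of Banach spaces over 𝕜 with p ∘ i = 0. Then the sequence 0 → F →(i) E →(p) D → 0 is exact (i injective, range(i) = ker(p), p surjective) if and only if the dual sequence 0 → D* →(p*) E* →(i*) F* → 0 is exact (p* injective, range(p*) = ker(i*), i* surjective). -/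
open NormedSpace

section

variable {𝕜 E F : Type*} [RCLike 𝕜]
  [NormedAddCommGroup E] [NormedSpace 𝕜 E] [NormedAddCommGroup F] [NormedSpace 𝕜 F]

/-- A closed subspace of a normed space contains every point at which all continuous functionals
vanishing on the subspace vanish. -/
theorem Submodule.mem_of_forall_dual_eq_zero (S : Submodule 𝕜 E) (hS : IsClosed (S : Set E))
    {x : E} (h : ∀ ψ : StrongDual 𝕜 E, (∀ y ∈ S, ψ y = 0) → ψ x = 0) : x ∈ S := by
  have : IsClosed (S : Set E) := hS
  rw [← Submodule.Quotient.mk_eq_zero]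
  refine SeparatingDual.eq_zero_of_forall_dual_eq_zero (R := 𝕜) fun φ => ?_
  refine h (φ.comp S.mkQL) fun y hy => ?_
  have : S.mkQL y = 0 := (Submodule.Quotient.mk_eq_zero S).2 hy
  simp only [ContinuousLinearMap.comp_apply, this, map_zero]

/-- A continuous linear map whose adjoint is surjective is bounded below. -/
theorem ContinuousLinearMap.exists_antilipschitzWith_of_surjective_dual (u : E →L[𝕜] F)
    (h : Function.Surjective fun ψ : StrongDual 𝕜 F => ψ.comp u) :
    ∃ K, AntilipschitzWith K u := by
  obtain ⟨C, hC, hpre⟩ :=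
    ((ContinuousLinearMap.compL 𝕜 E F 𝕜).flip u).exists_preimage_norm_le h
  refine ⟨⟨C, hC.le⟩, AddMonoidHomClass.antilipschitz_of_bound u fun x => ?_⟩
  obtain ⟨φ, hφ, hφx⟩ := exists_dual_vector'' 𝕜 x
  obtain ⟨ψ, hψ, hψC⟩ := hpre φ
  have hψx : ψ (u x) = φ x := DFunLike.congr_fun hψ x
  calc ‖x‖ = ‖ψ (u x)‖ := by rw [hψx, hφx]; simp
    _ ≤ ‖ψ‖ * ‖u x‖ := ψ.le_opNorm _
    _ ≤ C * ‖u x‖ := by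
      gcongr
      exact hψC.trans (mul_le_of_le_one_right hC.le hφ)

/-- A continuous linear map of Banach spaces whose adjoint is bijective is surjective. -/
theorem ContinuousLinearMap.surjective_of_bijective_dual [CompleteSpace E] (u : E →L[𝕜] F)
    (h : Function.Bijective fun ψ : StrongDual 𝕜 F => ψ.comp u) : Function.Surjective u := by
  obtain ⟨K, hK⟩ := u.exists_antilipschitzWith_of_surjective_dual h.2
  intro y
  refine Submodule.mem_of_forall_dual_eq_zero u.range (hK.isClosed_range u.uniformContinuous)
    fun ψ hψ => ?_
  have : ψ = 0 := h.1 (by ext x; simpa using hψ (u x) ⟨x, rfl⟩)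
  simp [this]

/-- A continuous functional vanishing on the kernel of a surjection of Banach spaces factors
through the surjection. -/
theorem ContinuousLinearMap.exists_dual_comp_eq_of_surjective [CompleteSpace E] [CompleteSpace F]
    (p : E →L[𝕜] F) (hp : Function.Surjective p) (ψ : StrongDual 𝕜 E)
    (hψ : ∀ x, p x = 0 → ψ x = 0) : ∃ χ : StrongDual 𝕜 F, χ.comp p = ψ := by
  obtain ⟨s, hs⟩ := hp.hasRightInverse
  have key : ∀ x, ψ (s (p x)) = ψ x := fun x =>
    sub_eq_zero.1 (by rw [← map_sub]; exact hψ _ (by rw [map_sub, hs, sub_self]))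
  let χ : F →ₗ[𝕜] 𝕜 :=
    { toFun := fun y => ψ (s y)
      map_add' := fun a b => by
        have := key (s a + s b)
        rwa [map_add, map_add, hs, hs] at this
      map_smul' := fun c a => by
        have := key (c • s a)
        rwa [map_smul, map_smul, hs] at this }
  have hχ : Continuous χ := (p.isQuotientMap hp).continuous_iff.2
    (ψ.continuous.congr fun x => (key x).symm)
  exact ⟨⟨χ, hχ⟩, ContinuousLinearMap.ext key⟩

/-- The adjoint of an injective map of Banach spaces with closed range is surjective. -/
theorem ContinuousLinearMap.surjective_dual_of_isClosed_range [CompleteSpace E] [CompleteSpace F]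
    (u : E →L[𝕜] F) (hu : Function.Injective u) (hc : IsClosed (Set.range u)) :
    Function.Surjective fun ψ : StrongDual 𝕜 F => ψ.comp u := by
  intro φ
  obtain ⟨ψ, hψ, -⟩ := exists_extension_norm_eq u.range
    (φ.comp ((u.equivRange hu hc).symm : u.range →L[𝕜] E))
  refine ⟨ψ, ContinuousLinearMap.ext fun x => (hψ ⟨u x, x, rfl⟩).trans ?_⟩
  exact congrArg φ (u.equivRange_symm_apply hu hc x)

/-- A continuous linear map of Banach spaces is surjective if its adjoint is injective and every
functional vanishing on its kernel lies in the range of the adjoint. -/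
theorem ContinuousLinearMap.surjective_of_dual [CompleteSpace E] (p : E →L[𝕜] F)
    (hinj : Function.Injective fun ψ : StrongDual 𝕜 F => ψ.comp p)
    (h : ∀ ψ : StrongDual 𝕜 E, (∀ x, p x = 0 → ψ x = 0) →
      ∃ χ : StrongDual 𝕜 F, χ.comp p = ψ) : Function.Surjective p := by
  have : IsClosed (p.ker : Set E) := p.isClosed_ker
  let q : E ⧸ p.ker →L[𝕜] F := p.ker.liftQL p le_rfl
  have hq : Function.Surjective q := by
    refine q.surjective_of_bijective_dual ⟨fun a b hab => hinj ?_, fun φ => ?_⟩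
    · exact ContinuousLinearMap.ext fun x => DFunLike.congr_fun hab (p.ker.mkQL x)
    · obtain ⟨χ, hχ⟩ := h (φ.comp p.ker.mkQL) fun x hx => by
        have : p.ker.mkQL x = 0 := (Submodule.Quotient.mk_eq_zero p.ker).2 hx
        simp only [ContinuousLinearMap.comp_apply, this, map_zero]
      refine ⟨χ, ContinuousLinearMap.ext fun z => ?_⟩
      obtain ⟨x, rfl⟩ := Submodule.Quotient.mk_surjective _ z
      exact DFunLike.congr_fun hχ x
  intro y
  obtain ⟨z, rfl⟩ := hq y
  obtain ⟨x, rfl⟩ := Submodule.Quotient.mk_surjective _ z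
  exact ⟨x, rfl⟩

end

/-- **Exactness of a short sequence of Banach spaces is equivalent to exactness
of its dual sequence.** -/
theorem exact_iff_dual_exact
    (𝕜 : Type) [RCLike 𝕜]
    (F E D : Type)
    [NormedAddCommGroup F] [NormedSpace 𝕜 F] [CompleteSpace F]
    [NormedAddCommGroup E] [NormedSpace 𝕜 E] [CompleteSpace E]
    [NormedAddCommGroup D] [NormedSpace 𝕜 D] [CompleteSpace D]
    (i : F →L[𝕜] E) (p : E →L[𝕜] D)
    (hpi : ∀ x : F, p (i x) = 0) :
    (Function.Injective i ∧ (∀ x : E, p x = 0 ↔ x ∈ Set.range i) ∧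
      Function.Surjective p)
    ↔
    (Function.Injective (fun ψ : StrongDual 𝕜 D => ψ.comp p) ∧
      (∀ ψ : StrongDual 𝕜 E, ψ.comp i = 0 ↔
        ψ ∈ Set.range (fun χ : StrongDual 𝕜 D => χ.comp p)) ∧
      Function.Surjective (fun ψ : StrongDual 𝕜 E => ψ.comp i)) := by
  constructor
  · rintro ⟨hi, hex, hp⟩
    have hrange : Set.range i = (p.ker : Set E) := Set.ext fun x => (hex x).symm
    refine ⟨fun a b hab => ContinuousLinearMap.ext fun y => ?_, fun ψ => ⟨fun hψ => ?_, ?_⟩,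
      i.surjective_dual_of_isClosed_range hi (hrange ▸ p.isClosed_ker)⟩
    · obtain ⟨x, rfl⟩ := hp y
      exact DFunLike.congr_fun hab x
    · refine p.exists_dual_comp_eq_of_surjective hp ψ fun x hx => ?_
      obtain ⟨z, rfl⟩ := (hex x).1 hx
      exact DFunLike.congr_fun hψ z
    · rintro ⟨χ, rfl⟩
      ext x
      simp [hpi]
  · rintro ⟨hpinj, hex, hisurj⟩
    obtain ⟨K, hK⟩ := i.exists_antilipschitzWith_of_surjective_dual hisurj
    refine ⟨hK.injective, fun x => ⟨fun hx => ?_, ?_⟩, p.surjective_of_dual hpinj fun ψ hψ => ?_⟩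
    · refine Submodule.mem_of_forall_dual_eq_zero i.range (hK.isClosed_range i.uniformContinuous)
        fun ψ hψ => ?_
      obtain ⟨χ, rfl⟩ := (hex ψ).1 (ContinuousLinearMap.ext fun z => hψ (i z) ⟨z, rfl⟩)
      simp [hx]
    · rintro ⟨z, rfl⟩
      exact hpi z
    · exact (hex ψ).1 (ContinuousLinearMap.ext fun z => hψ (i z) (hpi z))
end
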